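/- arXiv:2306.14440 — 2 statements merged into one kernel-verified Lean document; each statement's English description precedes it below -/
import Mathlib

section
/- Let S ⊆ ℝ² be a finite set and let p ∈ S be an extreme point of the convex hull of S. Then there exists a nonzero vector v ∈ ℝ² such that for every s ∈ S with s ≠ p one has ⟨v, s − p⟩ < 0; that is, all other points of S lie strictly inside the open half-plane {x : ⟨v, x − p⟩ < 0}. -/
/-- If `p ∈ S` is an extreme point of the convex hull of a finite set `S ⊆ ℝ²`, then there
is a nonzero vector `v` such that every other point of `S` lies strictly in the open
half-plane `{x : ⟨v, x − p⟩ < 0}`. -/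
theorem extreme_point_strictly_supporting_halfplane (S : Finset (ℝ × ℝ)) (p : ℝ × ℝ)
    (hpS : p ∈ S)
    (hp : p ∈ (convexHull ℝ (S : Set (ℝ × ℝ))).extremePoints ℝ) :
    ∃ v : ℝ × ℝ, v ≠ 0 ∧
      ∀ s ∈ S, s ≠ p → v.1 * (s.1 - p.1) + v.2 * (s.2 - p.2) < 0 := by
  have hpT : p ∉ convexHull ℝ ((S : Set (ℝ × ℝ)) \ {p}) := fun h =>
    (((convex_convexHull ℝ _).mem_extremePoints_iff_mem_sdiff_convexHull_sdiff).1 hp).2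
      (convexHull_mono (Set.sdiff_subset_sdiff_left (subset_convexHull ℝ _)) h)
  have hclosed : IsClosed (convexHull ℝ ((S : Set (ℝ × ℝ)) \ {p})) :=
    (S.finite_toSet.sdiff.isCompact_convexHull ℝ).isClosed
  obtain ⟨f, u, hf, hu⟩ :=
    geometric_hahn_banach_closed_point (convex_convexHull ℝ _) hclosed hpT
  have hfx (x : ℝ × ℝ) : f x = f (1, 0) * x.1 + f (0, 1) * x.2 := by
    have hx : x = x.1 • ((1, 0) : ℝ × ℝ) + x.2 • ((0, 1) : ℝ × ℝ) := by ext <;> simp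
    conv_lhs => rw [hx, map_add, map_smul, map_smul]
    simp only [smul_eq_mul]
    ring
  have hlt : ∀ s ∈ S, s ≠ p → f (1, 0) * (s.1 - p.1) + f (0, 1) * (s.2 - p.2) < 0 := by
    intro s hs hsp
    have h := hf s (subset_convexHull ℝ _ ⟨hs, hsp⟩)
    rw [hfx] at h hu
    linarith
  by_cases hv : ((f (1, 0), f (0, 1)) : ℝ × ℝ) = 0
  · obtain ⟨h₁, h₂⟩ := Prod.mk_eq_zero.1 hv
    refine ⟨(1, 0), by simp, fun s hs hsp => ?_⟩
    simpa [h₁, h₂] using hlt s hs hsp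
  · exact ⟨_, hv, hlt⟩
end

section
/- Let S ⊆ ℝ² be a finite set and let p ∈ S be an extreme point of the convex hull of S. Then there exist signs ε₁, ε₂ ∈ {1, −1} such that no point s ∈ S with s ≠ p satisfies both ε₁·(s₁ − p₁) ≥ 0 and ε₂·(s₂ − p₂) ≥ 0; that is, at least one of the four closed axis-aligned quadrants with apex p contains no point of S other than p itself. -/
/-- A point of a finite set that is extreme in its convex hull is strictly separated from the
other points of the set by a continuous linear functional. -/
theorem exists_forall_lt_of_mem_extremePoints_convexHull {E : Type*} [NormedAddCommGroup E]
    [NormedSpace ℝ E] {S : Set E} (hS : S.Finite) {p : E}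
    (hp : p ∈ (convexHull ℝ S).extremePoints ℝ) :
    ∃ f : E →L[ℝ] ℝ, ∀ s ∈ S, s ≠ p → f s < f p := by
  have hconv := ((convex_convexHull ℝ S).mem_extremePoints_iff_convex_sdiff.1 hp).2
  have hsub : convexHull ℝ (S \ {p}) ⊆ convexHull ℝ S \ {p} :=
    convexHull_min (Set.sdiff_subset_sdiff_left (subset_convexHull ℝ S)) hconv
  have hclosed : IsClosed (convexHull ℝ (S \ {p})) := hS.sdiff.isClosed_convexHull ℝ
  obtain ⟨f, u, hf, hu⟩ := geometric_hahn_banach_closed_point (convex_convexHull ℝ (S \ {p}))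
    hclosed (fun h => (hsub h).2 rfl)
  exact ⟨f, fun s hs hsp => (hf s (subset_convexHull ℝ _ ⟨hs, hsp⟩)).trans hu⟩

theorem exists_sign_mul_eq_abs (a : ℝ) : ∃ ε : ℝ, (ε = 1 ∨ ε = -1) ∧ a = |a| * ε := by
  rcases le_total 0 a with h | h
  · exact ⟨1, Or.inl rfl, by simp [abs_of_nonneg h]⟩
  · exact ⟨-1, Or.inr rfl, by simp [abs_of_nonpos h]⟩

/-- If `p ∈ S` is an extreme point of the convex hull of a finite set `S ⊆ ℝ²`, then at
least one of the four closed axis-aligned quadrants with apex `p` contains no point of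
`S` other than `p`. -/
theorem extreme_point_has_empty_quadrant (S : Finset (ℝ × ℝ)) (p : ℝ × ℝ)
    (hpS : p ∈ S)
    (hp : p ∈ (convexHull ℝ (S : Set (ℝ × ℝ))).extremePoints ℝ) :
    ∃ ε₁ ε₂ : ℝ, (ε₁ = 1 ∨ ε₁ = -1) ∧ (ε₂ = 1 ∨ ε₂ = -1) ∧
      ∀ s ∈ S, s ≠ p → ¬ (ε₁ * (s.1 - p.1) ≥ 0 ∧ ε₂ * (s.2 - p.2) ≥ 0) := by
  obtain ⟨f, hf⟩ := exists_forall_lt_of_mem_extremePoints_convexHull S.finite_toSet hp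
  obtain ⟨ε₁, hε₁, ha⟩ := exists_sign_mul_eq_abs (f (1, 0))
  obtain ⟨ε₂, hε₂, hb⟩ := exists_sign_mul_eq_abs (f (0, 1))
  refine ⟨ε₁, ε₂, hε₁, hε₂, fun s hs hsp ⟨h₁, h₂⟩ => (hf s hs hsp).not_ge ?_⟩
  have hdecomp : s - p = (s.1 - p.1) • ((1, 0) : ℝ × ℝ) + (s.2 - p.2) • ((0, 1) : ℝ × ℝ) := by
    ext <;> simp
  rw [← sub_nonneg, ← map_sub, hdecomp, map_add, map_smul, map_smul, smul_eq_mul, smul_eq_mul,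
    ha, hb]
  have h₃ := mul_nonneg (abs_nonneg (f (1, 0))) h₁
  have h₄ := mul_nonneg (abs_nonneg (f (0, 1))) h₂
  linarith
end
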